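/- Let d ≥ 2 and r ≥ 1 be integers, let Z ∈ ℝ^{d×r} have i.i.d. N(0,1) entries and set M := (1/r)·Z Zᵀ. Fix unit vectors v, v′ ∈ ℝ^d with ρ := ⟨v, v′⟩ ∈ [−1, 1], let y := M v, and define A := ((v′)ᵀ y)/(vᵀ y) and B := r·‖y‖²/(vᵀ y). Then there exist independent random variables K₁ ∼ χ²_r, K₂ ∼ N(0,1), K₃ ∼ χ²_{d−2} such that the pair (A, B) has the same joint distribution as (ρ + √(1−ρ²)·K₂/√K₁, K₁ + K₂² + K₃). In particular, A has the same distribution as ρ + √((1−ρ²)/r)·T_r where T_r is Student-t with r degrees of freedom, and B ∼ χ²_{d+r−1}. -/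

import Mathlib

open MeasureTheory ProbabilityTheory Matrix

/-- Chi-square distribution with `k` degrees of freedom. -/
noncomputable def chiSq (k : ℕ) : Measure ℝ :=
  Measure.map (fun x : Fin k → ℝ => ∑ i, (x i) ^ 2) (Measure.pi fun _ => gaussianReal 0 1)

/-- Student-t distribution with `r` degrees of freedom. -/
noncomputable def studentT (r : ℕ) : Measure ℝ :=
  Measure.map (fun p : ℝ × ℝ => p.1 / Real.sqrt (p.2 / r)) ((gaussianReal 0 1).prod (chiSq r))

lemma charFunDual_pi_gaussianReal {n : Type*} [Fintype n] [DecidableEq n]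
    (L : StrongDual ℝ (n → ℝ)) :
    charFunDual (Measure.pi fun _ : n => gaussianReal 0 1) L
      = Complex.exp (-((∑ i, L (Pi.single i 1) ^ 2 : ℝ) : ℂ) / 2) := by
  rw [charFunDual_pi, Complex.ofReal_sum, ← Finset.sum_neg_distrib, Finset.sum_div,
    Complex.exp_sum]
  refine Finset.prod_congr rfl fun i _ => ?_
  obtain ⟨c, hc⟩ : ∃ c, c = L (Pi.single i 1) := ⟨_, rfl⟩
  have hM : ∀ x : ℝ, L (Pi.single i x) = x * c := fun x => by
    rw [hc, ← smul_eq_mul, ← map_smul, ← Pi.single_smul, smul_eq_mul, mul_one]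
  have := charFun_gaussianReal (μ := 0) (v := 1) c
  rw [charFun_apply_real] at this
  rw [charFunDual_apply]
  simp only [ContinuousLinearMap.comp_apply, ContinuousLinearMap.single_apply]
  simp_rw [hM]
  simpa [mul_comm, neg_div] using this

lemma measurePreserving_mulVec_gaussianReal {m n : Type*} [Fintype m] [Fintype n] [DecidableEq m]
    (Q : Matrix m n ℝ) (hQ : Q * Qᵀ = 1) :
    MeasurePreserving (fun x => Q *ᵥ x) (Measure.pi fun _ : n => gaussianReal 0 1)
      (Measure.pi fun _ : m => gaussianReal 0 1) := by
  classical
  let F : (n → ℝ) →L[ℝ] (m → ℝ) := LinearMap.toContinuousLinearMap Q.mulVecLin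
  refine ⟨F.continuous.measurable, ?_⟩
  change Measure.map F _ = _
  have : IsProbabilityMeasure
      (Measure.map F (Measure.pi fun _ : n => gaussianReal 0 1)) :=
    Measure.isProbabilityMeasure_map F.continuous.measurable.aemeasurable
  refine Measure.ext_of_charFunDual (funext fun L => ?_)
  rw [charFunDual_map, charFunDual_pi_gaussianReal, charFunDual_pi_gaussianReal]
  have hL : ∀ x : m → ℝ, L x = x ⬝ᵥ fun i => L (Pi.single i 1) := fun x => by
    conv_lhs => rw [pi_eq_sum_univ' x, map_sum]
    exact Finset.sum_congr rfl fun i _ => by rw [map_smul, smul_eq_mul]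
  set w : m → ℝ := fun i => L (Pi.single i 1)
  have h1 : ∀ j, (L.comp F) (Pi.single j 1) = (w ᵥ* Q) j := fun j => by
    change L (Q *ᵥ Pi.single j 1) = _
    rw [hL, mulVec_single_one, vecMul, dotProduct_comm]
    rfl
  have h2 : ∑ j, (w ᵥ* Q) j ^ 2 = ∑ i, w i ^ 2 := by
    have : (w ᵥ* Q) ⬝ᵥ (w ᵥ* Q) = w ⬝ᵥ w := by
      rw [← dotProduct_mulVec, ← vecMul_transpose, vecMul_vecMul, hQ, vecMul_one]
    simpa [dotProduct, sq] using this
  simp_rw [h1, h2]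
  rfl

lemma measurePreserving_uncurry_pi {ι κ α : Type*} [Fintype ι] [Fintype κ] [MeasurableSpace α]
    (μ : Measure α) [SigmaFinite μ] :
    MeasurePreserving (Function.uncurry : (ι → κ → α) → ι × κ → α)
      (Measure.pi fun _ => Measure.pi fun _ => μ) (Measure.pi fun _ => μ) := by
  refine ⟨measurable_uncurry, (Measure.pi_eq fun s hs => ?_).symm⟩
  rw [Measure.map_apply measurable_uncurry (.univ_pi hs)]
  have : (Function.uncurry : (ι → κ → α) → ι × κ → α) ⁻¹' Set.univ.pi s
      = Set.univ.pi fun i => Set.univ.pi fun j => s (i, j) := by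
    ext f; simp [Prod.forall]
  simp_rw [this, Measure.pi_pi, Fintype.prod_prod_type]

open scoped Kronecker in
lemma measurePreserving_matrix_mul_gaussianReal {ι κ : Type*} [Fintype ι] [Fintype κ]
    [DecidableEq ι] (Q : Matrix ι ι ℝ) (hQ : Q * Qᵀ = 1) :
    MeasurePreserving (fun (z : ι → κ → ℝ) i j => ∑ k, Q i k * z k j)
      (Measure.pi fun _ => Measure.pi fun _ => gaussianReal 0 1)
      (Measure.pi fun _ => Measure.pi fun _ => gaussianReal 0 1) := by
  classical
  have hu := measurePreserving_uncurry_pi (ι := ι) (κ := κ) (gaussianReal 0 1)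
  have hc := hu.symm (MeasurableEquiv.curry ι κ ℝ).symm
  have hk := measurePreserving_mulVec_gaussianReal (Q ⊗ₖ (1 : Matrix κ κ ℝ))
    (by rw [← kroneckerMap_transpose, ← mul_kronecker_mul, hQ]; simp)
  convert hc.comp (hk.comp hu) using 1
  ext z i j
  simp [mulVec, dotProduct, Fintype.sum_prod_type, Matrix.one_apply]

lemma MeasureTheory.MeasurePreserving.of_comp_measurePreserving {α β γ : Type*}
    [MeasurableSpace α] [MeasurableSpace β] [MeasurableSpace γ] {μ : Measure α} {ν : Measure β}
    {π : Measure γ} {f : α → β} {g : β → γ} (hgf : MeasurePreserving (g ∘ f) μ π)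
    (hf : MeasurePreserving f μ ν) (hg : Measurable g) : MeasurePreserving g ν π :=
  ⟨hg, by rw [← hf.map_eq, Measure.map_map hg hf.measurable, hgf.map_eq]⟩

lemma measurePreserving_sum_sq_chiSq (n : ℕ) :
    MeasurePreserving (fun x : Fin n → ℝ => ∑ i, x i ^ 2)
      (Measure.pi fun _ => gaussianReal 0 1) (chiSq n) :=
  ⟨by fun_prop, rfl⟩

instance isProbabilityMeasure_chiSq (n : ℕ) : IsProbabilityMeasure (chiSq n) :=
  Measure.isProbabilityMeasure_map (measurePreserving_sum_sq_chiSq n).measurable.aemeasurable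

lemma measurePreserving_sq_add_chiSq (n : ℕ) :
    MeasurePreserving (fun p : ℝ × ℝ => p.1 ^ 2 + p.2) ((gaussianReal 0 1).prod (chiSq n))
      (chiSq (n + 1)) := by
  have hs := (measurePreserving_sum_sq_chiSq (n + 1)).comp
    (measurePreserving_piFinSuccAbove (fun _ => gaussianReal 0 1) 0).symm
  refine MeasurePreserving.of_comp_measurePreserving ?_
    ((MeasurePreserving.id (gaussianReal 0 1)).prod (measurePreserving_sum_sq_chiSq n))
    (by fun_prop)
  convert hs using 1
  ext p
  simp [Fin.sum_univ_succ, MeasurableEquiv.piFinSuccAbove]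

lemma measurePreserving_add_chiSq (m n : ℕ) :
    MeasurePreserving (fun p : ℝ × ℝ => p.1 + p.2) ((chiSq m).prod (chiSq n))
      (chiSq (m + n)) := by
  have hs := (measurePreserving_sum_sq_chiSq (m + n)).comp
    ((measurePreserving_piCongrLeft (fun _ => gaussianReal 0 1) finSumFinEquiv).comp
      (measurePreserving_sumPiEquivProdPi_symm fun _ : Fin m ⊕ Fin n => gaussianReal 0 1))
  refine MeasurePreserving.of_comp_measurePreserving ?_
    ((measurePreserving_sum_sq_chiSq m).prod (measurePreserving_sum_sq_chiSq n))
    (by fun_prop)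
  convert hs using 1
  ext p
  simp only [Function.comp_apply, Prod.map, ← Equiv.sum_comp finSumFinEquiv,
    MeasurableEquiv.coe_piCongrLeft, Equiv.piCongrLeft_apply_apply, Fintype.sum_sum_type]
  rfl

lemma measurePreserving_dotProduct_div_gaussianReal {n : Type*} [Fintype n] (a : n → ℝ)
    (ha : a ≠ 0) :
    MeasurePreserving (fun w : n → ℝ => w ⬝ᵥ a / √(∑ j, a j ^ 2))
      (Measure.pi fun _ => gaussianReal 0 1) (gaussianReal 0 1) := by
  have hpos : 0 < ∑ j, a j ^ 2 := by
    obtain ⟨j, hj⟩ := Function.ne_iff.1 ha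
    exact Finset.sum_pos' (fun _ _ => sq_nonneg _) ⟨j, Finset.mem_univ _, sq_pos_of_ne_zero hj⟩
  have hQ := measurePreserving_mulVec_gaussianReal
    (Matrix.of fun (_ : Unit) j => a j / √(∑ j, a j ^ 2)) (by
      ext i j
      simp only [mul_apply, transpose_apply, of_apply, one_apply, div_mul_div_comm,
        Real.mul_self_sqrt hpos.le, ← Finset.sum_div, if_true]
      simp_rw [← sq, div_self hpos.ne'])
  convert (measurePreserving_eval (fun _ : Unit => gaussianReal 0 1) ()).comp hQ using 1
  ext w
  simp [mulVec, dotProduct, Finset.sum_div, mul_comm, mul_div_right_comm]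

lemma ae_ne_zero_pi_gaussianReal (r : ℕ) (hr : 1 ≤ r) :
    ∀ᵐ g ∂(Measure.pi fun _ : Fin r => gaussianReal 0 1), g ≠ 0 := by
  have := nullSingletonClass_gaussianReal (μ := 0) (v := 1) one_ne_zero
  have : NullSingletonClass (Measure.pi fun _ : Fin r => gaussianReal 0 1) :=
    Measure.pi_nullSingletonClass ⟨0, hr⟩
  exact Measure.ae_ne _ _

/-- The squared norm of the first row of `c`, the inner product of the second row with the direction
of the first one, and the sum of the squares of the inner products of the remaining rows with it. -/
noncomputable def firstRowProjections {k r : ℕ} (c : Fin (k + 2) → Fin r → ℝ) : ℝ × ℝ × ℝ :=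
  (∑ j, c 0 j ^ 2, c 1 ⬝ᵥ c 0 / √(∑ j, c 0 j ^ 2),
    ∑ i : Fin k, (c i.succ.succ ⬝ᵥ c 0 / √(∑ j, c 0 j ^ 2)) ^ 2)

/-- For a matrix with independent standard Gaussian rows, the normalized projections of the other
rows on the first one are standard Gaussian, independent of each other and of the first row. -/
lemma measurePreserving_projections_on_first_row (k r : ℕ) (hr : 1 ≤ r) :
    MeasurePreserving firstRowProjections
      (Measure.pi fun _ : Fin (k + 2) => Measure.pi fun _ : Fin r => gaussianReal 0 1)
      ((chiSq r).prod ((gaussianReal 0 1).prod (chiSq k))) := by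
  have hsplit := measurePreserving_piFinSuccAbove
    (fun _ : Fin (k + 2) => Measure.pi fun _ : Fin r => gaussianReal 0 1) 0
  have hskew := (MeasurePreserving.id (Measure.pi fun _ : Fin r => gaussianReal 0 1)).skew_product
    (μc := Measure.pi fun _ : Fin (k + 1) => Measure.pi fun _ : Fin r => gaussianReal 0 1)
    (μd := Measure.pi fun _ : Fin (k + 1) => gaussianReal 0 1)
    (g := fun a w i => w i ⬝ᵥ a / √(∑ j, a j ^ 2))
    (by simp only [Function.uncurry_def, dotProduct]; fun_prop)
    ((ae_ne_zero_pi_gaussianReal r hr).mono fun a ha => (measurePreserving_pi _ _ fun _ =>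
      measurePreserving_dotProduct_div_gaussianReal a ha).map_eq)
  have hout := (measurePreserving_sum_sq_chiSq r).prod
    (((MeasurePreserving.id (gaussianReal 0 1)).prod (measurePreserving_sum_sq_chiSq k)).comp
      (measurePreserving_piFinSuccAbove (fun _ : Fin (k + 1) => gaussianReal 0 1) 0))
  exact hout.comp (hskew.comp hsplit)

lemma exists_orthogonal_matrix_of_unit_vectors (k : ℕ) (v v' : Fin (k + 2) → ℝ)
    (hv : v ⬝ᵥ v = 1) (hv' : v' ⬝ᵥ v' = 1) :
    ∃ Q : Matrix (Fin (k + 2)) (Fin (k + 2)) ℝ, Q * Qᵀ = 1 ∧ Q 0 = v ∧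
      v' = (v ⬝ᵥ v') • v + √(1 - (v ⬝ᵥ v') ^ 2) • Q 1 := by
  obtain ⟨ρ, hρ⟩ : ∃ ρ, ρ = v ⬝ᵥ v' := ⟨_, rfl⟩
  rw [← hρ]
  have hortho : (v' - ρ • v) ⬝ᵥ (v' - ρ • v) = 1 - ρ ^ 2 := by
    simp only [sub_dotProduct, dotProduct_sub, smul_dotProduct, dotProduct_smul, hv, hv',
      dotProduct_comm v' v, ← hρ, smul_eq_mul]
    ring
  have hle : 0 ≤ 1 - ρ ^ 2 := hortho ▸ Finset.sum_nonneg fun i _ => mul_self_nonneg _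
  have key : ∃ (w : Fin (k + 2) → EuclideanSpace ℝ (Fin (k + 2))) (s : Set (Fin (k + 2))),
      Orthonormal ℝ (s.domRestrict w) ∧ 0 ∈ s ∧ w 0 = WithLp.toLp 2 v ∧
      (√(1 - ρ ^ 2) ≠ 0 → 1 ∈ s ∧ w 1 = WithLp.toLp 2 ((√(1 - ρ ^ 2))⁻¹ • (v' - ρ • v))) := by
    have hnorm : ∀ x : Fin (k + 2) → ℝ, x ⬝ᵥ x = 1 → ‖WithLp.toLp 2 x‖ = 1 := fun x hx => by
      rw [norm_eq_sqrt_real_inner, EuclideanSpace.inner_toLp_toLp, star_trivial, hx, Real.sqrt_one]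
    by_cases h : √(1 - ρ ^ 2) = 0
    · refine ⟨fun _ => WithLp.toLp 2 v, {0}, ?_, rfl, rfl, fun h' => absurd h h'⟩
      refine ⟨fun _ => hnorm v hv, ?_⟩
      rintro ⟨i, rfl⟩ ⟨j, rfl⟩ hij
      exact absurd rfl hij
    · refine ⟨fun i => if i = 0 then WithLp.toLp 2 v else
        WithLp.toLp 2 ((√(1 - ρ ^ 2))⁻¹ • (v' - ρ • v)), {0, 1}, ?_, by simp, by simp,
        fun _ => by simp⟩
      have h11 : ((√(1 - ρ ^ 2))⁻¹ • (v' - ρ • v)) ⬝ᵥ ((√(1 - ρ ^ 2))⁻¹ • (v' - ρ • v)) = 1 := by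
        rw [smul_dotProduct, dotProduct_smul, hortho, smul_eq_mul, smul_eq_mul]
        nth_rewrite 3 [← Real.mul_self_sqrt hle]
        field_simp
      have h01 : v ⬝ᵥ ((√(1 - ρ ^ 2))⁻¹ • (v' - ρ • v)) = 0 := by
        rw [dotProduct_smul, dotProduct_sub, dotProduct_smul, hv, ← hρ]
        simp
      constructor
      · rintro ⟨i, rfl | rfl⟩
        exacts [hnorm _ hv, hnorm _ h11]
      · rintro ⟨i, rfl | rfl⟩ ⟨j, rfl | rfl⟩ hij
        · exact absurd rfl hij
        · exact (dotProduct_comm _ _).trans h01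
        · exact h01
        · exact absurd rfl hij
  obtain ⟨w, s, hw, h0, hw0, hw1⟩ := key
  obtain ⟨b, hb⟩ := hw.exists_orthonormalBasis_extension_of_card_eq (by simp)
  refine ⟨Matrix.of fun i => WithLp.ofLp (b i), ?_, ?_, ?_⟩
  · ext i j
    have := orthonormal_iff_ite.1 b.orthonormal j i
    simp only [EuclideanSpace.inner_eq_star_dotProduct, star_trivial] at this
    simp only [one_apply, eq_comm (a := i), ← this]
    rfl
  · change WithLp.ofLp (b 0) = v
    rw [hb 0 h0, hw0]
  · change v' = ρ • v + √(1 - ρ ^ 2) • WithLp.ofLp (b 1)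
    by_cases h : √(1 - ρ ^ 2) = 0
    · have : 1 - ρ ^ 2 = 0 := (Real.sqrt_eq_zero hle).1 h
      rw [this, dotProduct_self_eq_zero] at hortho
      rw [h, zero_smul, add_zero, ← sub_eq_zero, hortho]
    · rw [hb 1 (hw1 h).1, (hw1 h).2]
      simp [smul_smul, mul_inv_cancel₀ h]

lemma sum_sq_mulVec_of_mul_transpose_eq_one {n : Type*} [Fintype n] [DecidableEq n]
    (Q : Matrix n n ℝ) (hQ : Q * Qᵀ = 1) (y : n → ℝ) :
    ∑ i, (Q i ⬝ᵥ y) ^ 2 = ∑ i, y i ^ 2 := by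
  have : (Q *ᵥ y) ⬝ᵥ (Q *ᵥ y) = y ⬝ᵥ y := by
    rw [dotProduct_mulVec, ← mulVec_transpose, mulVec_mulVec, mul_eq_one_comm.1 hQ, one_mulVec]
  simpa [dotProduct, mulVec, sq] using this

lemma dotProduct_gram_mulVec {m n : Type*} [Fintype m] [Fintype n] (Z : Matrix m n ℝ) (t : ℝ)
    (u v : m → ℝ) : u ⬝ᵥ (t • ((Z * Zᵀ) *ᵥ v)) = t * ((u ᵥ* Z) ⬝ᵥ (v ᵥ* Z)) := by
  rw [dotProduct_smul, ← mulVec_mulVec, dotProduct_mulVec, mulVec_transpose, smul_eq_mul]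

lemma measurePreserving_div_sqrt_studentT (r : ℕ) :
    MeasurePreserving (fun p : ℝ × ℝ => p.2 / √(p.1 / r)) ((chiSq r).prod (gaussianReal 0 1))
      (studentT r) :=
  (⟨by fun_prop, rfl⟩ : MeasurePreserving (fun p : ℝ × ℝ => p.1 / √(p.2 / r))
    ((gaussianReal 0 1).prod (chiSq r)) (studentT r)).comp Measure.measurePreserving_swap

/-- The quotients `A` and `B` in terms of the rows of `Q * Z`, where `Q` is orthogonal and its first
two rows are `v` and a unit vector in the direction of the component of `v'` orthogonal to `v`. -/
lemma ratios_eq_of_orthogonal {k r : ℕ} (hr : 1 ≤ r)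
    (Q : Matrix (Fin (k + 2)) (Fin (k + 2)) ℝ) (hQ : Q * Qᵀ = 1)
    (Z : Matrix (Fin (k + 2)) (Fin r) ℝ) (c : Fin (k + 2) → Fin r → ℝ)
    (hc : ∀ i, c i = Q i ᵥ* Z) (h0 : c 0 ≠ 0) (v v' : Fin (k + 2) → ℝ) (ρ σ : ℝ)
    (hv : Q 0 = v) (hv' : v' = ρ • v + σ • Q 1) (y : Fin (k + 2) → ℝ)
    (hy : y = ((1 : ℝ) / r) • ((Z * Zᵀ) *ᵥ v)) :
    (v' ⬝ᵥ y) / (v ⬝ᵥ y)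
        = ρ + σ * (c 1 ⬝ᵥ c 0 / √(∑ j, c 0 j ^ 2)) / √(∑ j, c 0 j ^ 2) ∧
      (r : ℝ) * (∑ i, y i ^ 2) / (v ⬝ᵥ y)
        = ∑ j, c 0 j ^ 2 + (c 1 ⬝ᵥ c 0 / √(∑ j, c 0 j ^ 2)) ^ 2
          + ∑ i : Fin k, (c i.succ.succ ⬝ᵥ c 0 / √(∑ j, c 0 j ^ 2)) ^ 2 := by
  have hcy : ∀ i, Q i ⬝ᵥ y = 1 / r * (c i ⬝ᵥ c 0) := fun i => by
    rw [hy, dotProduct_gram_mulVec, hc, hc, hv]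
  have hr0 : (r : ℝ) ≠ 0 := by positivity
  have h00 : c 0 ⬝ᵥ c 0 = ∑ j, c 0 j ^ 2 := by simp [dotProduct, sq]
  have hS : 0 < ∑ j, c 0 j ^ 2 := by
    rw [← h00]
    exact lt_of_le_of_ne (Finset.sum_nonneg fun _ _ => mul_self_nonneg _)
      fun h => h0 (dotProduct_self_eq_zero.1 h.symm)
  have hB := sum_sq_mulVec_of_mul_transpose_eq_one Q hQ y
  rw [Fin.sum_univ_succ, Fin.sum_univ_succ] at hB
  simp_rw [hcy] at hB
  rw [← hB, hv', add_dotProduct, smul_dotProduct, smul_dotProduct, ← hv, hcy, hcy, h00]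
  simp_rw [div_pow, Real.sq_sqrt hS.le, ← Finset.sum_div, mul_pow, ← Finset.mul_sum, smul_eq_mul,
    mul_div_assoc, div_div, Real.mul_self_sqrt hS.le, Fin.succ_zero_eq_one]
  constructor
  · field_simp
  · field_simp
    ring

/-- distributional representation of
`A = (v'ᵀ y)/(vᵀ y)` and `B = r ‖y‖²/(vᵀ y)` for `y = M v`, `M = (1/r) Z Zᵀ` with i.i.d.
standard Gaussian `Z`.  The pair `(A, B)` is jointly distributed as
`(ρ + √(1−ρ²) K₂/√K₁, K₁ + K₂² + K₃)` for independent `K₁ ∼ χ²_r`, `K₂ ∼ N(0,1)`,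
`K₃ ∼ χ²_{d−2}`; in particular `A ∼ ρ + √((1−ρ²)/r)·T_r` and `B ∼ χ²_{d+r−1}`. -/
theorem stmt2
    {Ω : Type} [MeasureSpace Ω] [IsProbabilityMeasure (ℙ : Measure Ω)]
    (d r : ℕ) (hd : 2 ≤ d) (hr : 1 ≤ r)
    (Z : Ω → Fin d → Fin r → ℝ)
    (hZ : Measure.map Z ℙ
      = Measure.pi fun _ : Fin d => Measure.pi fun _ : Fin r => gaussianReal 0 1)
    (v v' : Fin d → ℝ) (hv : v ⬝ᵥ v = 1) (hv' : v' ⬝ᵥ v' = 1)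
    (ρ : ℝ) (hρ : ρ = v ⬝ᵥ v') (hρmem : ρ ∈ Set.Icc (-1 : ℝ) 1)
    (y : Ω → Fin d → ℝ)
    (hy : y = fun ω => ((1 : ℝ) / r) • ((Matrix.of (Z ω) * (Matrix.of (Z ω))ᵀ) *ᵥ v))
    (A B : Ω → ℝ)
    (hA : A = fun ω => (v' ⬝ᵥ y ω) / (v ⬝ᵥ y ω))
    (hB : B = fun ω => (r : ℝ) * (∑ i, (y ω i) ^ 2) / (v ⬝ᵥ y ω)) :
    Measure.map (fun ω => (A ω, B ω)) ℙ
      = Measure.map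
          (fun p : ℝ × ℝ × ℝ =>
            (ρ + Real.sqrt (1 - ρ ^ 2) * p.2.1 / Real.sqrt p.1, p.1 + p.2.1 ^ 2 + p.2.2))
          ((chiSq r).prod ((gaussianReal 0 1).prod (chiSq (d - 2)))) ∧
    Measure.map A ℙ
      = Measure.map (fun t => ρ + Real.sqrt ((1 - ρ ^ 2) / r) * t) (studentT r) ∧
    Measure.map B ℙ = chiSq (d + r - 1) := by
  obtain ⟨k, rfl⟩ : ∃ k, d = k + 2 := ⟨d - 2, by omega⟩
  obtain ⟨Q, hQ, hQv, hQv'⟩ := exists_orthogonal_matrix_of_unit_vectors k v v' hv hv'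
  rw [← hρ] at hQv'
  have hrot := measurePreserving_matrix_mul_gaussianReal (κ := Fin r) Q hQ
  have hproj := (measurePreserving_projections_on_first_row k r hr).comp hrot
  have hZm : AEMeasurable Z ℙ := by
    refine AEMeasurable.of_map_ne_zero ?_
    rw [hZ]
    exact IsProbabilityMeasure.ne_zero _
  have hne : ∀ᵐ ω ∂(ℙ : Measure Ω), (fun j => ∑ l, Q 0 l * Z ω l j) ≠ 0 := by
    refine ae_of_ae_map (p := fun z : Fin (k + 2) → Fin r → ℝ =>
      (fun j => ∑ l, Q 0 l * z l j) ≠ 0) hZm ?_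
    rw [hZ]
    exact ((measurePreserving_eval _ 0).comp hrot).quasiMeasurePreserving.ae
      (ae_ne_zero_pi_gaussianReal r hr)
  let Φ : ℝ × ℝ × ℝ → ℝ × ℝ := fun p =>
    (ρ + √(1 - ρ ^ 2) * p.2.1 / √p.1, p.1 + p.2.1 ^ 2 + p.2.2)
  have hΦ : Measurable Φ := by fun_prop
  have hAB : (fun ω => (A ω, B ω)) =ᵐ[ℙ]
      (Φ ∘ firstRowProjections ∘ fun (z : Fin (k + 2) → Fin r → ℝ) i j => ∑ l, Q i l * z l j) ∘ Z := by
    filter_upwards [hne] with ω hω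
    have := ratios_eq_of_orthogonal hr Q hQ (Matrix.of (Z ω)) (fun i j => ∑ l, Q i l * Z ω l j)
      (fun _ => rfl) hω v v' ρ _ hQv hQv' (y ω) (by rw [hy])
    rw [hA, hB]
    exact Prod.ext this.1 this.2
  have hjoint : Measure.map (fun ω => (A ω, B ω)) ℙ
      = Measure.map Φ ((chiSq r).prod ((gaussianReal 0 1).prod (chiSq k))) := by
    rw [Measure.map_congr hAB, ← AEMeasurable.map_map_of_aemeasurable
      (hΦ.comp hproj.measurable).aemeasurable hZm, hZ,
      ← Measure.map_map hΦ hproj.measurable, hproj.map_eq]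
  have hABm : AEMeasurable (fun ω => (A ω, B ω)) ℙ :=
    ((hΦ.comp hproj.measurable).comp_aemeasurable hZm).congr hAB.symm
  refine ⟨hjoint, ?_, ?_⟩
  · have h := congrArg (Measure.map Prod.fst) hjoint
    rw [AEMeasurable.map_map_of_aemeasurable measurable_fst.aemeasurable hABm,
      Measure.map_map measurable_fst hΦ] at h
    have hT := (measurePreserving_div_sqrt_studentT r).comp
      ((MeasurePreserving.id (chiSq r)).prod
        (measurePreserving_fst (μ := gaussianReal 0 1) (ν := chiSq k)))
    rw [← hT.map_eq, Measure.map_map (by fun_prop) hT.measurable]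
    refine h.trans (congrArg (Measure.map · _) (funext fun p => ?_))
    have hr0 : √(r : ℝ) ≠ 0 := by positivity
    simp only [Function.comp_apply, Prod.map, id, Φ, Real.sqrt_div' _ (Nat.cast_nonneg r)]
    field_simp
  · have h := congrArg (Measure.map Prod.snd) hjoint
    rw [AEMeasurable.map_map_of_aemeasurable measurable_snd.aemeasurable hABm,
      Measure.map_map measurable_snd hΦ] at h
    have hS := (measurePreserving_add_chiSq r (k + 1)).comp
      ((MeasurePreserving.id (chiSq r)).prod (measurePreserving_sq_add_chiSq k))
    rw [show k + 2 + r - 1 = r + (k + 1) by omega, ← hS.map_eq]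
    exact h.trans (congrArg (Measure.map · _) (funext fun p => add_assoc _ _ _))
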